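/- Let Ω ⊂ ℝ² be a nondegenerate closed triangle and let f : Ω → ℝ be bounded and Riemann integrable on Ω with integral mean μ (in the triangular-subdivision sense). For each N ≥ 1 let P_N = (x_{N,1},…,x_{N,N}) be a list of N points of Ω, and suppose D_N^P(P_N;Ω) → 0 as N → ∞. Then lim_{N→∞} (vol(Ω)/N)·Σ_{i=1}^{N} f(x_{N,i}) = μ·vol(Ω). -/

import Mathlib

open MeasureTheory Filter Real

noncomputable section

/-- Points of the plane. -/
abbrev Pt := ℝ × ℝ

/-- The (closed) triangle with vertices `A`, `B`, `C`: their convex hull. -/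
def triangle (A B C : Pt) : Set Pt := convexHull ℝ {A, B, C}

/-- The triangle `Δ(A,B,C)` is nondegenerate iff `A`, `B`, `C` are not collinear. -/
def Nondeg (A B C : Pt) : Prop := ¬ Collinear ℝ ({A, B, C} : Set Pt)

/-- Two-dimensional Lebesgue volume, as a real number. -/
def vol (S : Set Pt) : ℝ := (volume S).toReal

/-- Signed discrepancy `δ_N(S; P, Ω)` of the list of points `P` at the set `S`,
relative to the domain `Ω`. -/
def sdisc {N : ℕ} (S : Set Pt) (P : Fin N → Pt) (Ω : Set Pt) : ℝ :=
  vol (S ∩ Ω) / vol Ω - (Nat.card {i : Fin N // P i ∈ S} : ℝ) / N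

/-- Discrepancy `D_N(𝒮; P, Ω)`: supremum of the absolute signed discrepancy
over a class `𝒮` of sets. -/
def Disc {N : ℕ} (𝒮 : Set (Set Pt)) (P : Fin N → Pt) (Ω : Set Pt) : ℝ :=
  ⨆ S ∈ 𝒮, |sdisc S P Ω|

/-- The half-open parallelogram `𝒯_{a,b,C}` anchored at `C` with sides
`a(A-C)` and `b(B-C)`. -/
def parlg (A B C : Pt) (a b : ℝ) : Set Pt :=
  {x | ∃ s t : ℝ, 0 ≤ s ∧ s < a ∧ 0 ≤ t ∧ t < b ∧ x = C + s • (A - C) + t • (B - C)}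

/-- The family `𝒮_C` of parallelograms anchored at `C`, intersected with the triangle. -/
def anchoredFam (A B C : Pt) : Set (Set Pt) :=
  {S | ∃ a b : ℝ, 0 < a ∧ a ≤ 1 ∧ 0 < b ∧ b ≤ 1 ∧ S = parlg A B C a b ∩ triangle A B C}

/-- The class `𝒮_A ∪ 𝒮_B ∪ 𝒮_C` of anchored parallelograms of the triangle `Δ(A,B,C)`. -/
def parFam (A B C : Pt) : Set (Set Pt) :=
  anchoredFam B C A ∪ anchoredFam A C B ∪ anchoredFam A B C

/-- The parallelogram discrepancy `D_N^P(P; Δ(A,B,C))`. -/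
def parDisc {N : ℕ} (P : Fin N → Pt) (A B C : Pt) : ℝ :=
  Disc (parFam A B C) P (triangle A B C)

/-- Midpoint of two points. -/
def mid (P Q : Pt) : Pt := (2⁻¹ : ℝ) • (P + Q)

/-- A triangle recorded as the (ordered) triple of its vertices. -/
abbrev Tri2 := Pt × Pt × Pt

/-- The centroid of a triangle: the average of its three vertices. -/
def ctr (T : Tri2) : Pt := (3⁻¹ : ℝ) • (T.1 + T.2.1 + T.2.2)

/-- The point set of a triangle given by its vertices. -/
def triSet (T : Tri2) : Set Pt := triangle T.1 T.2.1 T.2.2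

/-- The four-way subdivision of a triangle: subtriangle number `d ∈ {0,1,2,3}`. -/
def subdiv (T : Tri2) (d : ℕ) : Tri2 :=
  let A := T.1; let B := T.2.1; let C := T.2.2
  if d = 0 then (mid B C, mid A C, mid A B)
  else if d = 1 then (A, mid A B, mid A C)
  else if d = 2 then (mid A B, B, mid B C)
  else (mid A C, mid B C, C)

/-- The triangular van der Corput point `f_T(i)`: digits of `i` in base `4` select a
nested subtriangle, and `f_T(i)` is its centroid. -/
def vdc (T : Tri2) (i : ℕ) : Pt :=
  if h : i = 0 then ctr T else vdc (subdiv T (i % 4)) (i / 4)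
termination_by i
decreasing_by exact Nat.div_lt_self (Nat.pos_of_ne_zero h) (by norm_num)

/-- The `i`-th subtriangle (for `i < 4^k`) of the standard level-`k` subdivision of `T`,
indexed by the base-4 digits of `i`. -/
def subdivAt (T : Tri2) : ℕ → ℕ → Tri2
  | 0, _ => T
  | (k+1), i => subdiv (subdivAt T k (i / 4)) (i % 4)

/-- The standard level-`k` subdivision of a triangle: the set of the `4^k` congruent
subtriangles obtained by `k` recursive four-way subdivisions. -/
def level (T : Tri2) : ℕ → Set Tri2
  | 0 => {T}
  | (k+1) => {S | ∃ S' ∈ level T k, ∃ d < 4, S = subdiv S' d}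

/-- Riemann integrability (in the triangular-subdivision sense) of `f` on the closed
triangle `T`, with integral mean `μ`: every sequence of tagged Riemann sums over the
level-`k` subdivisions converges to `μ`. -/
def RiemannMean (T : Tri2) (f : Pt → ℝ) (μ : ℝ) : Prop :=
  ∀ x : ℕ → ℕ → Pt, (∀ k i, i < 4^k → x k i ∈ triSet (subdivAt T k i)) →
    Tendsto (fun k => (4^k : ℝ)⁻¹ * ∑ i ∈ Finset.range (4^k), f (x k i)) atTop (nhds μ)

/-- A real number is a quadratic irrational if it has the form `(a + b√c)/d` with
integers `a,b,c,d`, `b ≠ 0`, `d ≠ 0`, `c > 0` and `c` not a perfect square. -/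
def QuadIrr (θ : ℝ) : Prop :=
  ∃ a b c d : ℤ, b ≠ 0 ∧ d ≠ 0 ∧ 0 < c ∧ (∀ m : ℤ, c ≠ m ^ 2) ∧
    θ = ((a : ℝ) + (b : ℝ) * Real.sqrt (c : ℝ)) / (d : ℝ)

/-- Distance from a real number to the nearest integer. -/
def distToInt (x : ℝ) : ℝ := |x - round x|

/-- A real number `θ` is badly approximable if `n‖nθ‖ > c` for all positive `n`,
for some constant `c > 0`. -/
def BadlyApprox (θ : ℝ) : Prop :=
  ∃ c : ℝ, 0 < c ∧ ∀ n : ℕ, 0 < n → c < (n : ℝ) * distToInt ((n : ℝ) * θ)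

end

section Geometry

lemma mem_triangle {A B C x : Pt} :
    x ∈ triangle A B C ↔
      ∃ a b c : ℝ, 0 ≤ a ∧ 0 ≤ b ∧ 0 ≤ c ∧ a + b + c = 1 ∧ x = a • A + b • B + c • C := by
  constructor
  · intro hx
    rw [triangle, convexHull_insert (by simp), convexHull_pair, mem_convexJoin] at hx
    obtain ⟨_, rfl, y, ⟨p, q, hp, hq, hpq, rfl⟩, ⟨r, s, hr, hs, hrs, rfl⟩⟩ := hx
    refine ⟨r, s * p, s * q, hr, by positivity, by positivity, ?_, ?_⟩
    · linear_combination hrs + s * hpq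
    · simp only [smul_add, smul_smul]; abel
  · rintro ⟨a, b, c, ha, hb, hc, h, rfl⟩
    have hconv := convex_convexHull ℝ ({A, B, C} : Set Pt)
    have hsub := subset_convexHull ℝ ({A, B, C} : Set Pt)
    have := hconv.sum_mem (t := Finset.univ) (w := ![a, b, c]) (z := ![A, B, C])
      (by intro i _; fin_cases i <;> simpa) (by simpa [Fin.sum_univ_three] using h)
      (by intro i _; fin_cases i <;> (apply hsub; simp))
    simpa [Fin.sum_univ_three, triangle] using this

lemma isCompact_triangle (A B C : Pt) : IsCompact (triangle A B C) :=
  Set.Finite.isCompact_convexHull (𝕜 := ℝ) (by simp)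

/-- Affine coordinates with respect to the frame `(C; A - C, B - C)`. -/
lemma exists_coords {A B C : Pt} (h : Nondeg A B C) :
    ∃ α β : Pt → ℝ, Continuous α ∧ Continuous β ∧
      (∀ x, x = C + α x • (A - C) + β x • (B - C)) ∧
      ∀ s t : ℝ, α (C + s • (A - C) + t • (B - C)) = s ∧
        β (C + s • (A - C) + t • (B - C)) = t := by
  obtain ⟨A₁, A₂⟩ := A
  obtain ⟨B₁, B₂⟩ := B
  obtain ⟨C₁, C₂⟩ := C
  have hD : (A₁ - C₁) * (B₂ - C₂) - (A₂ - C₂) * (B₁ - C₁) ≠ 0 := by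
    intro hD
    apply h
    rw [collinear_iff_of_mem (p₀ := (C₁, C₂)) (by simp)]
    by_cases hA : A₁ - C₁ = 0 ∧ A₂ - C₂ = 0
    · refine ⟨(B₁ - C₁, B₂ - C₂), ?_⟩
      simp only [Set.mem_insert_iff, Set.mem_singleton_iff, forall_eq_or_imp, forall_eq]
      refine ⟨⟨0, ?_⟩, ⟨1, ?_⟩, ⟨0, ?_⟩⟩ <;> ext <;> simp <;> linarith [hA.1, hA.2]
    · have hn : (A₁ - C₁) ^ 2 + (A₂ - C₂) ^ 2 ≠ 0 := by
        intro h0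
        exact hA ⟨by nlinarith [sq_nonneg (A₁ - C₁), sq_nonneg (A₂ - C₂)],
          by nlinarith [sq_nonneg (A₁ - C₁), sq_nonneg (A₂ - C₂)]⟩
      refine ⟨(A₁ - C₁, A₂ - C₂), ?_⟩
      simp only [Set.mem_insert_iff, Set.mem_singleton_iff, forall_eq_or_imp, forall_eq]
      refine ⟨⟨1, by simp⟩, ⟨((A₁ - C₁) * (B₁ - C₁) + (A₂ - C₂) * (B₂ - C₂)) /
        ((A₁ - C₁) ^ 2 + (A₂ - C₂) ^ 2), ?_⟩, ⟨0, by simp⟩⟩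
      ext
      · simp only [vadd_eq_add, Prod.smul_mk, Prod.mk_add_mk, smul_eq_mul]
        field_simp
        linear_combination (-(A₂ - C₂)) * hD
      · simp only [vadd_eq_add, Prod.smul_mk, Prod.mk_add_mk, smul_eq_mul]
        field_simp
        linear_combination (A₁ - C₁) * hD
  obtain ⟨E, hE⟩ : ∃ E, ((A₁ - C₁) * (B₂ - C₂) - (A₂ - C₂) * (B₁ - C₁)) * E = 1 :=
    ⟨_, mul_inv_cancel₀ hD⟩
  refine ⟨fun x => ((x.1 - C₁) * (B₂ - C₂) - (x.2 - C₂) * (B₁ - C₁)) * E,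
    fun x => ((A₁ - C₁) * (x.2 - C₂) - (A₂ - C₂) * (x.1 - C₁)) * E,
    by fun_prop, by fun_prop, ?_, ?_⟩
  · rintro ⟨x, y⟩
    ext <;> simp only [Prod.mk_sub_mk, Prod.smul_mk, Prod.mk_add_mk, smul_eq_mul]
    · linear_combination (C₁ - x) * hE
    · linear_combination (C₂ - y) * hE
  · intro s t
    constructor <;> simp only [Prod.mk_sub_mk, Prod.smul_mk, Prod.mk_add_mk, smul_eq_mul]
    · linear_combination s * hE
    · linear_combination t * hE

lemma mem_triangle_iff_coords {A B C : Pt} {α β : Pt → ℝ}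
    (hrep : ∀ x, x = C + α x • (A - C) + β x • (B - C))
    (hco : ∀ s t : ℝ, α (C + s • (A - C) + t • (B - C)) = s ∧
        β (C + s • (A - C) + t • (B - C)) = t) (x : Pt) :
    x ∈ triangle A B C ↔ 0 ≤ α x ∧ 0 ≤ β x ∧ α x + β x ≤ 1 := by
  rw [mem_triangle]
  constructor
  · rintro ⟨a, b, c, ha, hb, hc, h, rfl⟩
    have e : a • A + b • B + c • C = C + a • (A - C) + b • (B - C) := by
      obtain rfl : c = 1 - a - b := by linarith
      module
    rw [e, (hco a b).1, (hco a b).2]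
    exact ⟨ha, hb, by linarith⟩
  · rintro ⟨ha, hb, hc⟩
    refine ⟨α x, β x, 1 - α x - β x, ha, hb, by linarith, by ring, ?_⟩
    conv_lhs => rw [hrep x]
    module

lemma mem_parlg_iff_coords {A B C : Pt} {α β : Pt → ℝ}
    (hrep : ∀ x, x = C + α x • (A - C) + β x • (B - C))
    (hco : ∀ s t : ℝ, α (C + s • (A - C) + t • (B - C)) = s ∧
        β (C + s • (A - C) + t • (B - C)) = t) (a b : ℝ) (x : Pt) :
    x ∈ parlg A B C a b ↔ 0 ≤ α x ∧ α x < a ∧ 0 ≤ β x ∧ β x < b := by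
  constructor
  · rintro ⟨s, t, h1, h2, h3, h4, rfl⟩
    rw [(hco s t).1, (hco s t).2]
    exact ⟨h1, h2, h3, h4⟩
  · rintro ⟨h1, h2, h3, h4⟩
    exact ⟨_, _, h1, h2, h3, h4, hrep x⟩

lemma volume_triangle_pos {A B C : Pt} (h : Nondeg A B C) : 0 < volume (triangle A B C) := by
  obtain ⟨α, β, hα, hβ, hrep, hco⟩ := exists_coords h
  have hsub : {x | 0 < α x} ∩ {x | 0 < β x} ∩ {x | α x + β x < 1} ⊆ triangle A B C := by
    rintro x ⟨⟨h1, h2⟩, h3⟩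
    exact (mem_triangle_iff_coords hrep hco x).2 ⟨h1.le, h2.le, h3.le⟩
  refine lt_of_lt_of_le ?_ (measure_mono hsub)
  refine IsOpen.measure_pos volume (((isOpen_lt continuous_const hα).inter
    (isOpen_lt continuous_const hβ)).inter (isOpen_lt (hα.add hβ) continuous_const)) ?_
  refine ⟨C + (3⁻¹ : ℝ) • (A - C) + (3⁻¹ : ℝ) • (B - C), ?_⟩
  simp only [Set.mem_inter_iff, Set.mem_ofPred_eq, hco]
  norm_num

end Geometry

section Subdivision

lemma triSet_subdiv_eq_image (S : Tri2) {d : ℕ} (hd : d < 4) :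
    ∃ (p : Pt) (r : ℝ), r ^ 2 = 4⁻¹ ∧
      triSet (subdiv S d) = AffineMap.homothety p r '' triSet S := by
  obtain ⟨A, B, C⟩ := S
  simp only [triSet, triangle, AffineMap.image_convexHull, Set.image_insert_eq,
    Set.image_singleton]
  interval_cases d
  · refine ⟨ctr (A, B, C), -2⁻¹, by norm_num, ?_⟩
    congr 2
    · simp [subdiv, mid, ctr, AffineMap.homothety_apply]
      module
    · congr 1
      · simp [subdiv, mid, ctr, AffineMap.homothety_apply]
        module
      · simp [subdiv, mid, ctr, AffineMap.homothety_apply]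
        module
  · refine ⟨A, 2⁻¹, by norm_num, ?_⟩
    congr 2
    · simp [subdiv]
    · congr 1 <;> simp [subdiv, mid, AffineMap.homothety_apply] <;> module
  · refine ⟨B, 2⁻¹, by norm_num, ?_⟩
    congr 2
    · simp [subdiv, mid, AffineMap.homothety_apply]
      module
    · congr 1 <;> simp [subdiv, mid, AffineMap.homothety_apply]
      module
  · refine ⟨C, 2⁻¹, by norm_num, ?_⟩
    congr 2
    · simp [subdiv, mid, AffineMap.homothety_apply]
      module
    · congr 1 <;> simp [subdiv, mid, AffineMap.homothety_apply]
      module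

lemma volume_triSet_subdiv (S : Tri2) {d : ℕ} (hd : d < 4) :
    volume (triSet (subdiv S d)) = 4⁻¹ * volume (triSet S) := by
  obtain ⟨p, r, hr, e⟩ := triSet_subdiv_eq_image S hd
  rw [e, Measure.addHaar_image_homothety]
  have : Module.finrank ℝ Pt = 2 := by simp [Pt]
  rw [this, hr, abs_of_pos (by norm_num), ENNReal.ofReal_inv_of_pos (by norm_num)]
  simp

lemma mid_mem_triangle {A B C P Q : Pt} (hP : P ∈ triangle A B C) (hQ : Q ∈ triangle A B C) :
    mid P Q ∈ triangle A B C := by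
  rw [mid, smul_add]
  exact convex_convexHull ℝ _ hP hQ (by norm_num) (by norm_num) (by norm_num)

lemma triSet_subdiv_subset (S : Tri2) (d : ℕ) : triSet (subdiv S d) ⊆ triSet S := by
  obtain ⟨A, B, C⟩ := S
  have hA : A ∈ triangle A B C := subset_convexHull ℝ _ (by simp)
  have hB : B ∈ triangle A B C := subset_convexHull ℝ _ (by simp)
  have hC : C ∈ triangle A B C := subset_convexHull ℝ _ (by simp)
  refine convexHull_min ?_ (convex_convexHull ℝ _)
  change _ ⊆ triangle A B C
  have hBC := mid_mem_triangle hB hC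
  have hAC := mid_mem_triangle hA hC
  have hAB := mid_mem_triangle hA hB
  simp only [subdiv]
  split_ifs <;> simp [Set.insert_subset_iff, *]

lemma exists_mem_subdiv {S : Tri2} {x : Pt} (hx : x ∈ triSet S) :
    ∃ d < 4, x ∈ triSet (subdiv S d) := by
  obtain ⟨A, B, C⟩ := S
  obtain ⟨a, b, c, ha, hb, hc, h, rfl⟩ := mem_triangle.1 hx
  simp only
  by_cases h1 : 2⁻¹ ≤ a
  · refine ⟨1, by norm_num, mem_triangle.2 ⟨2 * a - 1, 2 * b, 2 * c, by linarith, by linarith,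
      by linarith, by linarith, ?_⟩⟩
    obtain rfl : a = 1 - b - c := by linarith
    simp only [subdiv, mid]
    norm_num
    module
  by_cases h2 : 2⁻¹ ≤ b
  · refine ⟨2, by norm_num, mem_triangle.2 ⟨2 * a, 2 * b - 1, 2 * c, by linarith, by linarith,
      by linarith, by linarith, ?_⟩⟩
    obtain rfl : b = 1 - a - c := by linarith
    simp only [subdiv, mid]
    norm_num
    module
  by_cases h3 : 2⁻¹ ≤ c
  · refine ⟨3, by norm_num, mem_triangle.2 ⟨2 * a, 2 * b, 2 * c - 1, by linarith, by linarith,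
      by linarith, by linarith, ?_⟩⟩
    obtain rfl : c = 1 - a - b := by linarith
    simp only [subdiv, mid]
    norm_num
    module
  · refine ⟨0, by norm_num, mem_triangle.2 ⟨1 - 2 * a, 1 - 2 * b, 1 - 2 * c, by linarith,
      by linarith, by linarith, by linarith, ?_⟩⟩
    obtain rfl : c = 1 - a - b := by linarith
    simp only [subdiv, mid]
    norm_num
    module

lemma triSet_subdivAt_subset (T : Tri2) (k i : ℕ) : triSet (subdivAt T k i) ⊆ triSet T := by
  induction k generalizing i with
  | zero => exact subset_rfl
  | succ k ih => exact (triSet_subdiv_subset _ _).trans (ih _)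

lemma volume_triSet_subdivAt (T : Tri2) (k i : ℕ) :
    volume (triSet (subdivAt T k i)) = (4 ^ k)⁻¹ * volume (triSet T) := by
  induction k generalizing i with
  | zero => simp [subdivAt]
  | succ k ih =>
    rw [subdivAt, volume_triSet_subdiv _ (Nat.mod_lt _ (by norm_num)), ih, ← mul_assoc, pow_succ,
      ENNReal.mul_inv (by simp) (by simp), mul_comm (4⁻¹ : ENNReal)]

lemma exists_mem_subdivAt {T : Tri2} {x : Pt} (hx : x ∈ triSet T) (k : ℕ) :
    ∃ i < 4 ^ k, x ∈ triSet (subdivAt T k i) := by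
  induction k with
  | zero => exact ⟨0, by norm_num, hx⟩
  | succ k ih =>
    obtain ⟨j, hj, hxj⟩ := ih
    obtain ⟨d, hd, hxd⟩ := exists_mem_subdiv hxj
    refine ⟨4 * j + d, by rw [pow_succ]; omega, ?_⟩
    have h1 : (4 * j + d) / 4 = j := by omega
    have h2 : (4 * j + d) % 4 = d := by omega
    rwa [subdivAt, h1, h2]

end Subdivision

section Discrepancy

lemma abs_sdisc_le_one {N : ℕ} (S : Set Pt) (P : Fin N → Pt) {Ω : Set Pt}
    (hΩ : volume Ω ≠ ⊤) : |sdisc S P Ω| ≤ 1 := by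
  have h1 : vol (S ∩ Ω) / vol Ω ≤ 1 :=
    div_le_one_of_le₀ (ENNReal.toReal_mono hΩ (measure_mono Set.inter_subset_right))
      ENNReal.toReal_nonneg
  have h2 : 0 ≤ vol (S ∩ Ω) / vol Ω := div_nonneg ENNReal.toReal_nonneg ENNReal.toReal_nonneg
  have h3 : (Nat.card {i : Fin N // P i ∈ S} : ℝ) / N ≤ 1 := by
    refine div_le_one_of_le₀ ?_ (Nat.cast_nonneg _)
    have := Nat.card_le_card_of_injective (Subtype.val : {i : Fin N // P i ∈ S} → Fin N)
      Subtype.val_injective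
    rw [Nat.card_fin] at this
    exact_mod_cast this
  have h4 : 0 ≤ (Nat.card {i : Fin N // P i ∈ S} : ℝ) / N := by positivity
  rw [sdisc, abs_le]
  constructor <;> linarith

lemma abs_sdisc_le_disc {N : ℕ} {𝒮 : Set (Set Pt)} {S : Set Pt} (hS : S ∈ 𝒮) (P : Fin N → Pt)
    {Ω : Set Pt} (hΩ : volume Ω ≠ ⊤) : |sdisc S P Ω| ≤ Disc 𝒮 P Ω := by
  have hbdd : BddAbove (Set.range fun S => ⨆ _ : S ∈ 𝒮, |sdisc S P Ω|) := by
    refine ⟨1, ?_⟩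
    rintro _ ⟨S, rfl⟩
    exact Real.iSup_le (fun _ => abs_sdisc_le_one S P hΩ) zero_le_one
  refine le_trans ?_ (le_ciSup hbdd S)
  simp [hS]

end Discrepancy

section Empirical

/-- The uniform probability measure on the points of a finite list. -/
noncomputable def empiricalMeasure {N : ℕ} (P : Fin N → Pt) : Measure Pt :=
  (N : ENNReal)⁻¹ • ∑ i, Measure.dirac (P i)

lemma empiricalMeasure_real {N : ℕ} (P : Fin N → Pt) (S : Set Pt) :
    (empiricalMeasure P).real S = (Nat.card {i : Fin N // P i ∈ S} : ℝ) / N := by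
  classical
  rw [empiricalMeasure, measureReal_ennreal_smul_apply, Measure.real, Measure.finsetSum_apply]
  simp only [Measure.dirac_apply, Set.indicator_apply, Pi.one_apply]
  rw [Finset.sum_boole, Nat.card_eq_fintype_card, Fintype.card_subtype]
  simp [div_eq_inv_mul]

instance {N : ℕ} (P : Fin (N + 1) → Pt) : IsProbabilityMeasure (empiricalMeasure P) := by
  refine ⟨?_⟩
  simp only [empiricalMeasure, Measure.smul_apply, Measure.finsetSum_apply, measure_univ,
    Finset.sum_const, Finset.card_univ, Fintype.card_fin, nsmul_eq_mul, mul_one, smul_eq_mul]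
  exact ENNReal.inv_mul_cancel (by simp) (by simp)

/-- The empirical measure of a nonempty list as a bundled probability measure. -/
noncomputable def empiricalProbability {N : ℕ} (P : Fin (N + 1) → Pt) : ProbabilityMeasure Pt :=
  ⟨empiricalMeasure P, inferInstance⟩

end Empirical
section WeakConvergence

open Topology

lemma measureReal_coordBox {m : Measure Pt} [IsProbabilityMeasure m] {α β : Pt → ℝ}
    (hα : Measurable α) (hβ : Measurable β) {a₁ a₂ b₁ b₂ : ℝ} (ha : a₁ ≤ a₂) (hb : b₁ ≤ b₂) :
    m.real {x | (a₁ ≤ α x ∧ α x < a₂) ∧ b₁ ≤ β x ∧ β x < b₂} =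
      (m.real {x | α x < a₂ ∧ β x < b₂} - m.real {x | α x < a₁ ∧ β x < b₂}) -
      (m.real {x | α x < a₂ ∧ β x < b₁} - m.real {x | α x < a₁ ∧ β x < b₁}) := by
  have hmeas (a b : ℝ) : MeasurableSet {x | α x < a ∧ β x < b} :=
    (measurableSet_lt hα measurable_const).inter (measurableSet_lt hβ measurable_const)
  have hsub (b : ℝ) : {x | α x < a₁ ∧ β x < b} ⊆ {x | α x < a₂ ∧ β x < b} :=
    fun x hx => ⟨hx.1.trans_le ha, hx.2⟩
  rw [← measureReal_sdiff (hsub b₂) (hmeas _ _), ← measureReal_sdiff (hsub b₁) (hmeas _ _),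
    ← measureReal_sdiff _ ((hmeas _ _).diff (hmeas _ _))]
  · congr 1
    ext x
    simp only [Set.mem_ofPred_eq, Set.mem_sdiff]
    grind
  · intro x
    simp only [Set.mem_ofPred_eq, Set.mem_sdiff]
    grind

/-- Convergence along anchored boxes with corner at most `(1, 1)` implies convergence along all
quadrants, provided the limit gives full mass to the unit box. -/
lemma tendsto_measureReal_quadrant {m : ℕ → Measure Pt} {ν : Measure Pt}
    [∀ n, IsProbabilityMeasure (m n)] [IsProbabilityMeasure ν] {α β : Pt → ℝ}
    (hα : Measurable α) (hβ : Measurable β)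
    (hm : ∀ n, ∀ᵐ x ∂m n, 0 ≤ α x ∧ 0 ≤ β x) (hν : ∀ᵐ x ∂ν, 0 ≤ α x ∧ 0 ≤ β x)
    (hone : ν.real {x | α x < 1 ∧ β x < 1} = 1)
    (hlim : ∀ a b : ℝ, 0 < a → a ≤ 1 → 0 < b → b ≤ 1 →
      Tendsto (fun n => (m n).real {x | α x < a ∧ β x < b}) atTop
        (𝓝 (ν.real {x | α x < a ∧ β x < b}))) (a b : ℝ) :
    Tendsto (fun n => (m n).real {x | α x < a ∧ β x < b}) atTop
      (𝓝 (ν.real {x | α x < a ∧ β x < b})) := by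
  have hmeas (a b : ℝ) : MeasurableSet {x | α x < a ∧ β x < b} :=
    (measurableSet_lt hα measurable_const).inter (measurableSet_lt hβ measurable_const)
  by_cases hab : 0 < a ∧ 0 < b
  · obtain ⟨ha, hb⟩ := hab
    have hlow (p : Measure Pt) [IsProbabilityMeasure p] :
        p.real {x | α x < min a 1 ∧ β x < min b 1} ≤ p.real {x | α x < a ∧ β x < b} :=
      measureReal_mono fun x hx => ⟨hx.1.trans_le (min_le_left _ _), hx.2.trans_le (min_le_left _ _)⟩
    have hup (p : Measure Pt) [IsProbabilityMeasure p] :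
        p.real {x | α x < a ∧ β x < b} ≤ p.real {x | α x < min a 1 ∧ β x < min b 1} +
          (1 - p.real {x | α x < 1 ∧ β x < 1}) := by
      rw [← probReal_compl_eq_one_sub (hmeas 1 1)]
      refine (measureReal_mono ?_).trans (measureReal_union_le _ _)
      intro x
      simp only [Set.mem_ofPred_eq, Set.mem_union, Set.mem_compl_iff, lt_min_iff]
      tauto
    have hl := hlim (min a 1) (min b 1) (by positivity) (min_le_right _ _) (by positivity)
      (min_le_right _ _)
    have h1 := hlim 1 1 one_pos le_rfl one_pos le_rfl
    have e : ν.real {x | α x < a ∧ β x < b} = ν.real {x | α x < min a 1 ∧ β x < min b 1} := by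
      have := hup ν
      rw [hone] at this
      exact le_antisymm (by linarith) (hlow ν)
    rw [e]
    refine tendsto_of_tendsto_of_tendsto_of_le_of_le hl ?_ (fun n => hlow (m n))
      (fun n => hup (m n))
    have := hl.add (h1.const_sub 1)
    rwa [hone, sub_self, add_zero] at this
  · have hzero (p : Measure Pt) (hp : ∀ᵐ x ∂p, 0 ≤ α x ∧ 0 ≤ β x) :
        p.real {x | α x < a ∧ β x < b} = 0 := by
      rw [Measure.real, ENNReal.toReal_eq_zero_iff]
      left
      rw [measure_eq_zero_iff_ae_notMem]
      filter_upwards [hp] with x hx hx'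
      exact hab ⟨hx.1.trans_lt hx'.1, hx.2.trans_lt hx'.2⟩
    rw [hzero ν hν]
    exact tendsto_const_nhds.congr fun n => (hzero (m n) (hm n)).symm

/-- In affine coordinates of the plane, convergence along quadrants implies weak convergence. -/
lemma tendsto_probabilityMeasure_of_quadrant {m : ℕ → ProbabilityMeasure Pt}
    {ν : ProbabilityMeasure Pt} {A B C : Pt} {α β : Pt → ℝ}
    (hα : Continuous α) (hβ : Continuous β)
    (hrep : ∀ x, x = C + α x • (A - C) + β x • (B - C))
    (hlim : ∀ a b : ℝ, Tendsto (fun n => (m n : Measure Pt).real {x | α x < a ∧ β x < b}) atTop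
      (𝓝 ((ν : Measure Pt).real {x | α x < a ∧ β x < b}))) :
    Tendsto m atTop (𝓝 ν) := by
  let 𝒮 : Set (Set Pt) := {S | ∃ a₁ a₂ b₁ b₂ : ℝ, a₁ ≤ a₂ ∧ b₁ ≤ b₂ ∧
    S = {x | (a₁ ≤ α x ∧ α x < a₂) ∧ b₁ ≤ β x ∧ β x < b₂}}
  refine IsPiSystem.tendsto_probabilityMeasure_of_tendsto_of_mem (S := 𝒮) ?_ ?_ ?_ ?_
  · rintro _ ⟨a₁, a₂, b₁, b₂, -, -, rfl⟩ _ ⟨c₁, c₂, d₁, d₂, -, -, rfl⟩ ⟨x, hx, hx'⟩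
    simp only [Set.mem_ofPred_eq] at hx hx'
    refine ⟨max a₁ c₁, min a₂ c₂, max b₁ d₁, min b₂ d₂, ?_, ?_, ?_⟩
    · exact (max_le hx.1.1 hx'.1.1).trans (lt_min hx.1.2 hx'.1.2).le
    · exact (max_le hx.2.1 hx'.2.1).trans (lt_min hx.2.2 hx'.2.2).le
    · ext y
      simp only [Set.mem_inter_iff, Set.mem_ofPred_eq, max_le_iff, lt_min_iff]
      tauto
  · rintro _ ⟨a₁, a₂, b₁, b₂, -, -, rfl⟩
    exact ((measurableSet_le measurable_const hα.measurable).inter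
      (measurableSet_lt hα.measurable measurable_const)).inter
      ((measurableSet_le measurable_const hβ.measurable).inter
      (measurableSet_lt hβ.measurable measurable_const))
  · intro u hu x hx
    have hΦ : Continuous fun p : ℝ × ℝ => C + p.1 • (A - C) + p.2 • (B - C) := by fun_prop
    have hmem : (fun p : ℝ × ℝ => C + p.1 • (A - C) + p.2 • (B - C)) ⁻¹' u ∈ 𝓝 (α x, β x) := by
      refine (hu.preimage hΦ).mem_nhds ?_
      rw [Set.mem_preimage]
      simpa only [← hrep x] using hx
    obtain ⟨ε, hε, hball⟩ := Metric.mem_nhds_iff.1 hmem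
    refine ⟨_, ⟨α x - ε / 2, α x + ε / 2, β x - ε / 2, β x + ε / 2, by linarith, by linarith, rfl⟩,
      ?_, ?_⟩
    · refine mem_of_superset (IsOpen.mem_nhds (s := {y | (α x - ε / 2 < α y ∧ α y < α x + ε / 2) ∧
          β x - ε / 2 < β y ∧ β y < β x + ε / 2}) ?_ ?_) ?_
      · exact ((isOpen_lt continuous_const hα).inter (isOpen_lt hα continuous_const)).inter
          ((isOpen_lt continuous_const hβ).inter (isOpen_lt hβ continuous_const))
      · simp only [Set.mem_ofPred_eq]
        refine ⟨⟨?_, ?_⟩, ?_, ?_⟩ <;> linarith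
      · exact fun y hy => ⟨⟨hy.1.1.le, hy.1.2⟩, hy.2.1.le, hy.2.2⟩
    · rintro y ⟨⟨h1, h2⟩, h3, h4⟩
      have hy : (α y, β y) ∈ Metric.ball (α x, β x) ε := by
        rw [Metric.mem_ball, Prod.dist_eq, max_lt_iff, Real.dist_eq, Real.dist_eq, abs_lt, abs_lt]
        refine ⟨⟨?_, ?_⟩, ?_, ?_⟩ <;> simp only <;> linarith
      have := hball hy
      rw [Set.mem_preimage] at this
      simpa only [← hrep y] using this
  · rintro _ ⟨a₁, a₂, b₁, b₂, ha, hb, rfl⟩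
    rw [← NNReal.tendsto_coe]
    change Tendsto (fun n => (m n : Measure Pt).real _) atTop (𝓝 ((ν : Measure Pt).real _))
    simp only [measureReal_coordBox hα.measurable hβ.measurable ha hb]
    exact ((hlim _ _).sub (hlim _ _)).sub ((hlim _ _).sub (hlim _ _))

end WeakConvergence

section Equidistribution

open Topology ProbabilityTheory

lemma measurableSet_triangle (A B C : Pt) : MeasurableSet (triangle A B C) :=
  (isCompact_triangle A B C).measurableSet

lemma cond_triangle_real {A B C : Pt} (S : Set Pt) :
    (volume[|triangle A B C]).real S = vol (S ∩ triangle A B C) / vol (triangle A B C) := by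
  rw [Measure.real, cond_apply (measurableSet_triangle A B C), ENNReal.toReal_mul,
    ENNReal.toReal_inv, Set.inter_comm, vol, vol, div_eq_inv_mul]

lemma ae_mem_empiricalMeasure {N : ℕ} {P : Fin N → Pt} {S : Set Pt} (hP : ∀ i, P i ∈ S) :
    ∀ᵐ x ∂empiricalMeasure P, x ∈ S := by
  rw [ae_iff]
  simp [empiricalMeasure, hP]

/-- Vanishing parallelogram discrepancy implies weak convergence to the uniform measure. -/
lemma tendsto_empiricalMeasure {A B C : Pt} (h : Nondeg A B C)
    {Q : (n : ℕ) → Fin (n + 1) → Pt} (hQ : ∀ n i, Q n i ∈ triangle A B C)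
    (hD : Tendsto (fun n => parDisc (Q n) A B C) atTop (𝓝 0))
    (ν : ProbabilityMeasure Pt) (hν : (ν : Measure Pt) = volume[|triangle A B C]) :
    Tendsto (fun n => empiricalProbability (Q n)) atTop
      (𝓝 ν) := by
  obtain ⟨α, β, hα, hβ, hrep, hco⟩ := exists_coords h
  have hvol := volume_triangle_pos h
  have hvol' : volume (triangle A B C) ≠ ⊤ := (isCompact_triangle A B C).measure_lt_top.ne
  have hT := mem_triangle_iff_coords hrep hco
  have hm : ∀ n, ∀ᵐ x ∂empiricalMeasure (Q n), x ∈ triangle A B C :=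
    fun n => ae_mem_empiricalMeasure (hQ n)
  have hνT : ∀ᵐ x ∂(ν : Measure Pt), x ∈ triangle A B C := by
    rw [hν]
    exact ae_cond_mem (measurableSet_triangle A B C)
  have hae {p : Measure Pt} (hp : ∀ᵐ x ∂p, x ∈ triangle A B C) (a b : ℝ) :
      p.real {x | α x < a ∧ β x < b} = p.real (parlg A B C a b ∩ triangle A B C) := by
    refine measureReal_congr ?_
    filter_upwards [hp] with x hx
    refine propext ?_
    change (α x < a ∧ β x < b) ↔ (x ∈ parlg A B C a b ∧ x ∈ triangle A B C)
    rw [mem_parlg_iff_coords hrep hco]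
    have := (hT x).1 hx
    tauto
  refine tendsto_probabilityMeasure_of_quadrant hα hβ hrep ?_
  refine tendsto_measureReal_quadrant (m := fun n => empiricalMeasure (Q n)) hα.measurable
    hβ.measurable (fun n => ?_) ?_ ?_ ?_
  · filter_upwards [hm n] with x hx using ⟨((hT x).1 hx).1, ((hT x).1 hx).2.1⟩
  · filter_upwards [hνT] with x hx using ⟨((hT x).1 hx).1, ((hT x).1 hx).2.1⟩
  · have hAB : ∀ᵐ x ∂(ν : Measure Pt), x ∉ ({A, B} : Set Pt) := by
      rw [← measure_eq_zero_iff_ae_notMem, hν]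
      exact cond_absolutelyContinuous (Set.Finite.measure_zero (by simp) _)
    have : {x | α x < 1 ∧ β x < 1} =ᵐ[(ν : Measure Pt)] Set.univ := by
      filter_upwards [hνT, hAB] with x hx hx'
      refine propext (iff_of_true ?_ trivial)
      change α x < 1 ∧ β x < 1
      obtain ⟨h1, h2, h3⟩ := (hT x).1 hx
      simp only [Set.mem_insert_iff, Set.mem_singleton_iff, not_or] at hx'
      constructor
      · by_contra! h4
        apply hx'.1
        rw [hrep x, show α x = 1 by linarith, show β x = 0 by linarith]
        module
      · by_contra! h4
        apply hx'.2
        rw [hrep x, show α x = 0 by linarith, show β x = 1 by linarith]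
        module
    rw [measureReal_congr this, probReal_univ]
  · intro a b ha ha1 hb hb1
    rw [tendsto_iff_dist_tendsto_zero]
    refine squeeze_zero (fun _ => dist_nonneg) (fun n => ?_) hD
    rw [hae (hm n), hae hνT, hν, cond_triangle_real, empiricalMeasure_real, dist_comm,
      Real.dist_eq]
    exact abs_sdisc_le_disc (Or.inr ⟨a, b, ha, ha1, hb, hb1, rfl⟩) (Q n) hvol'

/-- Vanishing parallelogram discrepancy bounds the asymptotic frequency in each cell of the
subdivision. -/
lemma eventually_empiricalMeasure_cell_le {T : Tri2} (h : Nondeg T.1 T.2.1 T.2.2)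
    {Q : (n : ℕ) → Fin (n + 1) → Pt} (hQ : ∀ n i, Q n i ∈ triSet T)
    (hD : Tendsto (fun n => parDisc (Q n) T.1 T.2.1 T.2.2) atTop (𝓝 0)) (k i : ℕ)
    {δ : ℝ} (hδ : 0 < δ) :
    ∀ᶠ n in atTop, (empiricalMeasure (Q n)).real (triSet (subdivAt T k i)) ≤
      (4 ^ k)⁻¹ + δ := by
  have hvol := volume_triangle_pos h
  have hvol' : volume (triSet T) ≠ ⊤ := (isCompact_triangle _ _ _).measure_lt_top.ne
  let ν : ProbabilityMeasure Pt :=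
    ⟨volume[|triSet T], cond_isProbabilityMeasure_of_finite hvol.ne' hvol'⟩
  have hlim := tendsto_empiricalMeasure h hQ hD ν rfl
  have hcell : (ν : Measure Pt) (triSet (subdivAt T k i)) = ENNReal.ofReal (4 ^ k)⁻¹ := by
    change volume[|triangle T.1 T.2.1 T.2.2] _ = _
    rw [cond_apply (measurableSet_triangle _ _ _),
      Set.inter_eq_right.2 (show _ ⊆ triangle T.1 T.2.1 T.2.2 from triSet_subdivAt_subset T k i),
      volume_triSet_subdivAt, triSet,
      mul_left_comm, ENNReal.inv_mul_cancel hvol.ne' hvol', mul_one,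
      ENNReal.ofReal_inv_of_pos (by positivity), ENNReal.ofReal_pow (by norm_num)]
    norm_num
  have hsup := ProbabilityMeasure.limsup_measure_closed_le_of_tendsto hlim
    (F := triSet (subdivAt T k i)) (isCompact_triangle _ _ _).isClosed
  rw [hcell] at hsup
  have hlt := hsup.trans_lt ((ENNReal.ofReal_lt_ofReal_iff (q := (4 ^ k)⁻¹ + δ)
    (by positivity)).2 (by linarith))
  filter_upwards [eventually_lt_of_limsup_lt hlt] with n hn
  exact ENNReal.toReal_le_of_le_ofReal (by positivity) hn.le

end Equidistribution

section Quadrature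

open Topology

/-- Upper Riemann sums of a Riemann integrable function come close to the mean. -/
lemma exists_upperSum_le {T : Tri2} {g : Pt → ℝ} {M μ : ℝ} (hM : ∀ x ∈ triSet T, g x ≤ M)
    (hμ : RiemannMean T g μ) {ε : ℝ} (hε : 0 < ε) :
    ∃ (k : ℕ) (u : ℕ → ℝ), (∀ i, ∀ x ∈ triSet (subdivAt T k i), g x ≤ u i) ∧
      (4 ^ k : ℝ)⁻¹ * ∑ i ∈ Finset.range (4 ^ k), u i ≤ μ + ε := by
  have hbdd (k i : ℕ) : BddAbove (g '' triSet (subdivAt T k i)) := by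
    refine ⟨M, ?_⟩
    rintro _ ⟨x, hx, rfl⟩
    exact hM x (triSet_subdivAt_subset T k i hx)
  have hne (k i : ℕ) : (g '' triSet (subdivAt T k i)).Nonempty :=
    ⟨_, _, subset_convexHull ℝ _ (Set.mem_insert _ _), rfl⟩
  have hx (k i : ℕ) : ∃ x ∈ triSet (subdivAt T k i),
      sSup (g '' triSet (subdivAt T k i)) - ε / 2 < g x := by
    obtain ⟨_, ⟨x, hx, rfl⟩, h⟩ := exists_lt_of_lt_csSup (hne k i)
      (sub_lt_self (sSup (g '' triSet (subdivAt T k i))) (half_pos hε))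
    exact ⟨x, hx, h⟩
  choose x hxmem hxlt using hx
  obtain ⟨k, hk⟩ := ((hμ x fun k i _ => hxmem k i).eventually_lt_const
    (show μ < μ + ε / 2 by linarith)).exists
  refine ⟨k, fun i => sSup (g '' triSet (subdivAt T k i)),
    fun i y hy => le_csSup (hbdd k i) ⟨y, hy, rfl⟩, ?_⟩
  have hsum : ∑ i ∈ Finset.range (4 ^ k), sSup (g '' triSet (subdivAt T k i)) ≤
      ∑ i ∈ Finset.range (4 ^ k), (g (x k i) + ε / 2) :=
    Finset.sum_le_sum fun i _ => by linarith [hxlt k i]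
  rw [Finset.sum_add_distrib, Finset.sum_const, Finset.card_range, nsmul_eq_mul] at hsum
  push_cast at hsum
  have h4 : (0 : ℝ) < 4 ^ k := by positivity
  calc (4 ^ k : ℝ)⁻¹ * ∑ i ∈ Finset.range (4 ^ k), sSup (g '' triSet (subdivAt T k i))
      ≤ (4 ^ k : ℝ)⁻¹ * (∑ i ∈ Finset.range (4 ^ k), g (x k i) + 4 ^ k * (ε / 2)) := by gcongr
    _ = (4 ^ k : ℝ)⁻¹ * ∑ i ∈ Finset.range (4 ^ k), g (x k i) + ε / 2 := by
      rw [mul_add, inv_mul_cancel_left₀ h4.ne']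
    _ ≤ μ + ε := by linarith

/-- The average over a list is controlled by cell bounds and cell frequencies. -/
lemma average_le_sum_cells {T : Tri2} {g : Pt → ℝ} (hg : ∀ x ∈ triSet T, 0 ≤ g x) {k : ℕ}
    {u : ℕ → ℝ} (hu : ∀ i, ∀ x ∈ triSet (subdivAt T k i), g x ≤ u i) {N : ℕ} {P : Fin N → Pt}
    (hP : ∀ j, P j ∈ triSet T) :
    (∑ j, g (P j)) / N ≤ ∑ i ∈ Finset.range (4 ^ k),
      u i * (empiricalMeasure P).real (triSet (subdivAt T k i)) := by
  classical
  have hu0 (i : ℕ) : 0 ≤ u i := by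
    have hmem : (subdivAt T k i).1 ∈ triSet (subdivAt T k i) :=
      subset_convexHull ℝ _ (Set.mem_insert _ _)
    exact (hg _ (triSet_subdivAt_subset T k i hmem)).trans (hu i _ hmem)
  have hpt (j : Fin N) : g (P j) ≤ ∑ i ∈ Finset.range (4 ^ k),
      u i * if P j ∈ triSet (subdivAt T k i) then 1 else 0 := by
    obtain ⟨i, hi, hmem⟩ := exists_mem_subdivAt (hP j) k
    refine le_trans ?_ (Finset.single_le_sum (fun i _ => mul_nonneg (hu0 i) ?_)
      (Finset.mem_range.2 hi))
    · simpa [hmem] using hu i _ hmem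
    · split_ifs <;> norm_num
  have hfreq (i : ℕ) : (empiricalMeasure P).real (triSet (subdivAt T k i)) =
      (∑ j, if P j ∈ triSet (subdivAt T k i) then (1 : ℝ) else 0) / N := by
    rw [empiricalMeasure_real, Finset.sum_boole, Nat.card_eq_fintype_card, Fintype.card_subtype]
  calc (∑ j, g (P j)) / N
      ≤ (∑ j, ∑ i ∈ Finset.range (4 ^ k),
          u i * if P j ∈ triSet (subdivAt T k i) then 1 else 0) / N := by
        gcongr with j
        exact hpt j
    _ = _ := by
        rw [Finset.sum_comm, Finset.sum_div]
        refine Finset.sum_congr rfl fun i _ => ?_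
        rw [hfreq, ← Finset.mul_sum, mul_div_assoc]

lemma eventually_average_le {T : Tri2} (h : Nondeg T.1 T.2.1 T.2.2) {g : Pt → ℝ} {M μ : ℝ}
    (hg : ∀ x ∈ triSet T, 0 ≤ g x) (hM : ∀ x ∈ triSet T, g x ≤ M) (hμ : RiemannMean T g μ)
    {Q : (n : ℕ) → Fin (n + 1) → Pt} (hQ : ∀ n i, Q n i ∈ triSet T)
    (hD : Tendsto (fun n => parDisc (Q n) T.1 T.2.1 T.2.2) atTop (𝓝 0)) {ε : ℝ} (hε : 0 < ε) :
    ∀ᶠ n in atTop, (∑ j, g (Q n j)) / (n + 1 : ℕ) < μ + ε := by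
  obtain ⟨k, u, hu, hsum⟩ := exists_upperSum_le hM hμ (ε := ε / 3) (by positivity)
  have hu0 (i : ℕ) : 0 ≤ u i := by
    have hmem : (subdivAt T k i).1 ∈ triSet (subdivAt T k i) :=
      subset_convexHull ℝ _ (Set.mem_insert _ _)
    exact (hg _ (triSet_subdivAt_subset T k i hmem)).trans (hu i _ hmem)
  set s := ∑ i ∈ Finset.range (4 ^ k), u i with hs
  have hs0 : 0 ≤ s := Finset.sum_nonneg fun i _ => hu0 i
  have hδ : 0 < ε / 3 / (s + 1) := by positivity
  have hev : ∀ᶠ n in atTop, ∀ i ∈ Finset.range (4 ^ k),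
      (empiricalMeasure (Q n)).real (triSet (subdivAt T k i)) ≤ (4 ^ k)⁻¹ + ε / 3 / (s + 1) :=
    (Filter.eventually_all_finset _).2 fun i _ =>
      eventually_empiricalMeasure_cell_le h hQ hD k i hδ
  filter_upwards [hev] with n hn
  calc (∑ j, g (Q n j)) / (n + 1 : ℕ)
      ≤ ∑ i ∈ Finset.range (4 ^ k),
          u i * (empiricalMeasure (Q n)).real (triSet (subdivAt T k i)) :=
        average_le_sum_cells hg hu (hQ n)
    _ ≤ ∑ i ∈ Finset.range (4 ^ k), u i * ((4 ^ k)⁻¹ + ε / 3 / (s + 1)) :=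
        Finset.sum_le_sum fun i hi => mul_le_mul_of_nonneg_left (hn i hi) (hu0 i)
    _ = (4 ^ k)⁻¹ * s + s / (s + 1) * (ε / 3) := by
        rw [← Finset.sum_mul, ← hs]
        ring
    _ ≤ (μ + ε / 3) + 1 * (ε / 3) := by
        gcongr
        exact div_le_one_of_le₀ (by linarith) (by linarith)
    _ < μ + ε := by linarith

lemma RiemannMean.const_add {T : Tri2} {f : Pt → ℝ} {μ : ℝ} (hμ : RiemannMean T f μ) (c : ℝ) :
    RiemannMean T (fun x => c + f x) (c + μ) := by
  intro x hx
  refine ((hμ x hx).const_add c).congr fun k => ?_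
  rw [Finset.sum_add_distrib, Finset.sum_const, Finset.card_range, nsmul_eq_mul, mul_add]
  push_cast
  rw [inv_mul_cancel_left₀ (by positivity)]

lemma RiemannMean.neg {T : Tri2} {f : Pt → ℝ} {μ : ℝ} (hμ : RiemannMean T f μ) :
    RiemannMean T (fun x => -f x) (-μ) := by
  intro x hx
  refine (hμ x hx).neg.congr fun k => ?_
  rw [Finset.sum_neg_distrib, mul_neg]

end Quadrature

/-- if `f` is bounded and Riemann integrable (triangular-subdivision
sense) with mean `μ` on the nondegenerate closed triangle `Ω`, and the lists `P_N` of
`N` points of `Ω` have vanishing parallelogram discrepancy, then the equal-weight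
quadrature estimates converge to `μ · vol(Ω)`. -/
theorem quadrature_of_riemann (T : Tri2) (h : Nondeg T.1 T.2.1 T.2.2)
    (f : Pt → ℝ) (Mb : ℝ) (hb : ∀ x ∈ triSet T, |f x| ≤ Mb)
    (μ : ℝ) (hμ : RiemannMean T f μ)
    (P : (N : ℕ) → Fin N → Pt) (hP : ∀ N i, P N i ∈ triSet T)
    (hD : Tendsto (fun N => parDisc (P N) T.1 T.2.1 T.2.2) atTop (nhds 0)) :
    Tendsto (fun N : ℕ => vol (triSet T) / N * ∑ i : Fin N, f (P N i))
      atTop (nhds (μ * vol (triSet T))) := by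
  have hD' := (tendsto_add_atTop_iff_nat 1).2 hD
  have hP' : ∀ n i, P (n + 1) i ∈ triSet T := fun n i => hP _ i
  have havg (c : ℝ) (g : Pt → ℝ) (n : ℕ) : (∑ j, (c + g (P (n + 1) j))) / (n + 1 : ℕ) =
      c + (∑ j, g (P (n + 1) j)) / (n + 1 : ℕ) := by
    rw [Finset.sum_add_distrib, Finset.sum_const, Finset.card_univ, Fintype.card_fin,
      nsmul_eq_mul, add_div, mul_div_cancel_left₀ _ (by positivity)]
  have key : Tendsto (fun n : ℕ => (∑ j, f (P (n + 1) j)) / (n + 1 : ℕ)) atTop (nhds μ) := by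
    rw [tendsto_order]
    constructor
    · intro a ha
      have := eventually_average_le h (g := fun x => Mb + -f x) (M := Mb + Mb)
        (fun x hx => by linarith [(abs_le.1 (hb x hx)).2])
        (fun x hx => by linarith [(abs_le.1 (hb x hx)).1]) (hμ.neg.const_add Mb) hP' hD'
        (sub_pos.2 ha)
      filter_upwards [this] with n hn
      rw [havg Mb (fun x => -f x), Finset.sum_neg_distrib, neg_div] at hn
      linarith
    · intro a ha
      have := eventually_average_le h (g := fun x => Mb + f x) (M := Mb + Mb)
        (fun x hx => by linarith [(abs_le.1 (hb x hx)).1])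
        (fun x hx => by linarith [(abs_le.1 (hb x hx)).2]) (hμ.const_add Mb) hP' hD'
        (sub_pos.2 ha)
      filter_upwards [this] with n hn
      rw [havg Mb f] at hn
      linarith
  rw [← tendsto_add_atTop_iff_nat 1]
  refine (key.mul_const (vol (triSet T))).congr fun n => ?_
  rw [div_mul_eq_mul_div, div_mul_eq_mul_div, mul_comm]
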